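/- Fix m ≥ 3, α ∈ [1 − 1/m, 1], and rankings R_1,…,R_n over A_m, and let ≻_1,…,≻_n be mutually independent random rankings with ≻_i drawn from the α-IC distribution π_{R_i}. Fix distinct alternatives a, b ∈ A_m and let β = (3/4 − 1/(2m))·n/m. Then Pr[ #{i ∈ [n] : a ⋖_i b} < β ] < exp(−n/(72 m²)). -/

import Mathlib

open Finset
open scoped Classical

/-- A ranking over `m` alternatives: `R a` is the position of alternative `a`,
position `0` being the top. -/
abbrev Ranking (m : ℕ) := Fin m ≃ Fin m

/-- The `α`-Impartial-Culture distribution centered at the ranking `R`: each ranking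
`R'` gets probability `α/m! + (1−α)·1[R' = R]`. -/
noncomputable def alphaIC {m : ℕ} (α : ℝ) (R : Ranking m) : Ranking m → ℝ :=
  fun R' => α / (Nat.factorial m : ℝ) + (1 - α) * (if R' = R then 1 else 0)

/-- Probability of the event `Ev` when the `n` voters' rankings are drawn mutually
independently, voter `i`'s ranking from the distribution `π i` (product measure). -/
noncomputable def profileProb {n m : ℕ} (π : Fin n → Ranking m → ℝ)
    (Ev : (Fin n → Ranking m) → Prop) : ℝ :=
  ∑ P ∈ univ.filter Ev, ∏ i : Fin n, π i (P i)

/-- The symmetric group acts 2-transitively. -/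
theorem exists_perm_map_pair {ι : Type*} {i j i' j' : ι} (h : i ≠ j) (h' : i' ≠ j') :
    ∃ g : Equiv.Perm ι, g i = i' ∧ g j = j' := by
  have hne : i' ≠ Equiv.swap i i' j := fun hc => h <| by
    rw [← Equiv.swap_apply_left i i'] at hc
    exact (Equiv.swap i i').injective (by simpa using hc)
  refine ⟨Equiv.swap (Equiv.swap i i' j) j' * Equiv.swap i i', ?_, ?_⟩
  · rw [Equiv.Perm.mul_apply, Equiv.swap_apply_left, Equiv.swap_apply_of_ne_of_ne hne h']
  · rw [Equiv.Perm.mul_apply, Equiv.swap_apply_left]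

theorem card_rankings_map_pair_eq {m : ℕ} (a b : Fin m) {i j i' j' : Fin m}
    (h : i ≠ j) (h' : i' ≠ j') :
    (univ.filter fun σ : Ranking m => (σ a, σ b) = (i, j)).card =
      (univ.filter fun σ : Ranking m => (σ a, σ b) = (i', j')).card := by
  obtain ⟨g, rfl, rfl⟩ := exists_perm_map_pair h h'
  refine Finset.card_bij (fun σ _ => σ.trans g) ?_ ?_ ?_
  · intro σ hσ
    simpa using hσ
  · intro σ _ τ _ hστ
    ext x
    have := congrArg (fun f : Ranking m => f x) hστ
    simpa [Fin.val_inj] using this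
  · intro τ hτ
    refine ⟨τ.trans g.symm, ?_, ?_⟩
    · simp only [mem_filter_univ, Prod.mk.injEq] at hτ ⊢
      simp [hτ.1, hτ.2]
    · ext x
      simp

theorem card_consecutive_pairs (m : ℕ) :
    ((univ : Finset (Fin m × Fin m)).filter fun p => (p.1 : ℕ) = p.2 + 1).card = m - 1 := by
  rcases m with _ | k
  · simp
  · have : ((univ : Finset (Fin (k + 1) × Fin (k + 1))).filter
        fun p => (p.1 : ℕ) = p.2 + 1) =
        univ.image fun j : Fin k => (j.succ, j.castSucc) := by
      ext ⟨x, y⟩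
      simp only [mem_filter_univ, mem_image, mem_univ, true_and, Prod.mk.injEq, Fin.ext_iff,
        Fin.val_succ, Fin.val_castSucc]
      constructor
      · intro h
        exact ⟨⟨y, by omega⟩, h.symm, rfl⟩
      · rintro ⟨j, h1, h2⟩
        omega
    rw [this, card_image_of_injective]
    · simp
    · intro x y h
      simpa using congrArg Prod.snd h

/-- Exactly a fraction `1 / m` of all rankings place `b` immediately above `a`. -/
theorem mul_card_immediatelyAbove {m : ℕ} {a b : Fin m} (hab : a ≠ b) :
    m * (univ.filter fun σ : Ranking m => (σ a : ℕ) = (σ b : ℕ) + 1).card = m.factorial := by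
  have hm : 0 < m := a.pos
  set N := (univ.filter fun σ : Ranking m => (σ a, σ b) = (a, b)).card with hN
  have htotal : m.factorial = (m * m - m) * N := by
    have h := card_eq_sum_card_fiberwise (f := fun σ : Ranking m => (σ a, σ b))
      (s := univ) (t := univ.offDiag)
      (fun σ _ => by simpa using fun h => hab h)
    rw [sum_congr rfl (g := fun _ => N), sum_const, offDiag_card] at h
    · simpa [Fintype.card_perm] using h
    · rintro ⟨i, j⟩ hij
      exact card_rankings_map_pair_eq a b (by simpa using hij) hab
  have hevent : (univ.filter fun σ : Ranking m => (σ a : ℕ) = (σ b : ℕ) + 1).card =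
      (m - 1) * N := by
    have h := card_eq_sum_card_fiberwise (f := fun σ : Ranking m => (σ a, σ b))
      (s := univ.filter fun σ : Ranking m => (σ a : ℕ) = (σ b : ℕ) + 1)
      (t := (univ : Finset (Fin m × Fin m)).filter fun p => (p.1 : ℕ) = p.2 + 1)
      (fun σ hσ => by simpa using hσ)
    rw [sum_congr rfl (g := fun _ => N), sum_const, card_consecutive_pairs] at h
    · simpa using h
    · rintro ⟨i, j⟩ hij
      simp only [mem_filter_univ] at hij
      rw [hN, ← card_rankings_map_pair_eq a b (i := i) (j := j) _ hab, filter_filter]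
      · congr 1
        ext σ
        simp only [mem_filter_univ, Prod.mk.injEq, and_iff_right_iff_imp]
        rintro ⟨rfl, rfl⟩
        exact hij
      · rintro rfl
        omega
  rw [hevent, htotal, ← mul_assoc, Nat.mul_sub_one]

theorem alphaIC_nonneg {m : ℕ} {α : ℝ} (h0 : 0 ≤ α) (h1 : α ≤ 1) (R σ : Ranking m) :
    0 ≤ alphaIC α R σ := by
  have : 0 ≤ 1 - α := by linarith
  unfold alphaIC
  positivity

theorem sum_alphaIC {m : ℕ} (α : ℝ) (R : Ranking m) : ∑ σ, alphaIC α R σ = 1 := by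
  have : (m.factorial : ℝ) ≠ 0 := by positivity
  simp only [alphaIC, sum_add_distrib, sum_const, card_univ, Fintype.card_perm,
    Fintype.card_fin, nsmul_eq_mul, ← mul_sum, sum_ite_eq', mem_univ, if_true]
  field_simp
  ring

/-- Under `α`-IC, `b` is immediately above `a` with probability at least `α / m`. -/
theorem div_le_sum_alphaIC_immediatelyAbove {m : ℕ} {α : ℝ} (h1 : α ≤ 1)
    (R : Ranking m) {a b : Fin m} (hab : a ≠ b) :
    α / m ≤ ∑ σ ∈ univ.filter fun σ : Ranking m => (σ a : ℕ) = (σ b : ℕ) + 1,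
      alphaIC α R σ := by
  have hm : (m : ℝ) ≠ 0 := by exact_mod_cast a.pos.ne'
  have hc := congrArg (Nat.cast : ℕ → ℝ) (mul_card_immediatelyAbove hab)
  push_cast at hc
  have hf : (m.factorial : ℝ) ≠ 0 := by positivity
  have h1' : 0 ≤ 1 - α := by linarith
  calc α / m = ∑ σ ∈ univ.filter fun σ : Ranking m => (σ a : ℕ) = (σ b : ℕ) + 1,
        α / (m.factorial : ℝ) := by
        rw [sum_const, nsmul_eq_mul]
        field_simp
        linear_combination (-α) * hc
    _ ≤ _ := by
        refine sum_le_sum fun σ _ => ?_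
        unfold alphaIC
        exact le_add_of_nonneg_right (by positivity)

theorem sum_mul_exp_indicator {ι : Type*} [Fintype ι] (w : ι → ℝ)
    (E : ι → Prop) (t : ℝ) :
    ∑ x, w x * Real.exp (-t * (if E x then 1 else 0)) =
      ∑ x, w x - (1 - Real.exp (-t)) * ∑ x ∈ univ.filter E, w x := by
  rw [mul_sum, sum_filter, ← sum_sub_distrib]
  refine sum_congr rfl fun x _ => ?_
  by_cases h : E x
  · simp only [h, if_true, mul_one]
    ring
  · simp [h]

/-- Exponential Markov inequality for the lower tail of the number of voters whose
ranking satisfies `E`. -/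
theorem profileProb_card_lt_le {n m : ℕ} (π : Fin n → Ranking m → ℝ)
    (hπ : ∀ i σ, 0 ≤ π i σ) (E : Ranking m → Prop) (c : ℝ) {t : ℝ} (ht : 0 ≤ t) :
    profileProb π (fun P => ((univ.filter fun i => E (P i)).card : ℝ) < c) ≤
      Real.exp (t * c) * ∏ i, ∑ σ, π i σ * Real.exp (-t * (if E σ then 1 else 0)) := by
  rw [prod_univ_sum, Fintype.piFinset_univ, mul_sum, profileProb]
  have hw : ∀ P : Fin n → Ranking m, 0 ≤ ∏ i, π i (P i) :=
    fun P => prod_nonneg fun i _ => hπ i _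
  refine (sum_le_sum fun P hP => ?_).trans
    (sum_le_sum_of_subset_of_nonneg (filter_subset _ _) fun P _ _ => ?_)
  · have hc : ((univ.filter fun i => E (P i)).card : ℝ) < c := (mem_filter.mp hP).2
    rw [prod_mul_distrib, ← Real.exp_sum, ← mul_sum, sum_boole, mul_left_comm,
      ← Real.exp_add]
    refine le_mul_of_one_le_right (hw P) (Real.one_le_exp ?_)
    nlinarith
  · exact mul_nonneg (Real.exp_pos _).le
      (prod_nonneg fun i _ => mul_nonneg (hπ i _) (Real.exp_pos _).le)

theorem exp_neg_le_quadratic {t : ℝ} (ht : 0 ≤ t) : Real.exp (-t) ≤ 1 - t + t ^ 2 / 2 := by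
  have h := Real.quadratic_le_exp_of_nonneg ht
  have hpos : 0 ≤ 1 - t + t ^ 2 / 2 := by nlinarith [sq_nonneg (t - 1)]
  rw [Real.exp_neg, inv_le_iff_one_le_mul₀ (Real.exp_pos t)]
  calc (1 : ℝ) ≤ (1 - t + t ^ 2 / 2) * (1 + t + t ^ 2 / 2) := by nlinarith [sq_nonneg (t ^ 2)]
    _ ≤ _ := mul_le_mul_of_nonneg_left h hpos

/-- with each voter `i` drawing independently from the `α`-IC
distribution `π_{R i}` (`1 − 1/m ≤ α ≤ 1`), for distinct `a b` and
`β = (3/4 − 1/(2m))·n/m`, the probability that fewer than `β` voters rank `b`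
immediately above `a` is less than `exp(−n/(72·m²))`. -/
theorem alphaIC_immediatelyAbove_tail (m n : ℕ) (hm : 3 ≤ m) (α : ℝ)
    (hα1 : 1 - 1 / (m : ℝ) ≤ α) (hα2 : α ≤ 1)
    (R : Fin n → Ranking m) (a b : Fin m) (hab : a ≠ b) :
    profileProb (fun i => alphaIC α (R i))
        (fun P => (((univ.filter fun i => (P i a : ℕ) = (P i b : ℕ) + 1).card : ℝ) <
          (3 / 4 - 1 / (2 * (m : ℝ))) * (n : ℝ) / (m : ℝ)))
      < Real.exp (-(n : ℝ) / (72 * (m : ℝ) ^ 2)) := by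
  rcases Nat.eq_zero_or_pos n with rfl | hn
  · simp [profileProb]
  have hm' : (3 : ℝ) ≤ m := by exact_mod_cast hm
  have hn' : (0 : ℝ) < n := by exact_mod_cast hn
  set x : ℝ := 1 / m with hx
  have hx0 : 0 < x := by positivity
  have hx3 : x ≤ 1 / 3 := one_div_le_one_div_of_le (by norm_num) hm'
  have hα0 : 0 ≤ α := by linarith
  set t : ℝ := x / 3 with ht
  have ht0 : 0 < t := by positivity
  set y : ℝ := (1 - Real.exp (-t)) * ((1 - x) * x) with hy
  have hexp : 0 < 1 - Real.exp (-t) := by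
    have := Real.exp_lt_one_iff.mpr (neg_lt_zero.mpr ht0)
    linarith
  have hp0 : 0 < (1 - x) * x := mul_pos (by linarith) hx0
  have hp1 : (1 - x) * x ≤ 1 / 4 := by nlinarith [sq_nonneg (x - 1 / 2)]
  have hy0 : 0 < y := mul_pos hexp hp0
  have hmgf : ∀ i, ∑ σ, alphaIC α (R i) σ *
      Real.exp (-t * (if (σ a : ℕ) = (σ b : ℕ) + 1 then 1 else 0)) ≤ 1 - y := by
    intro i
    have h := sum_mul_exp_indicator (alphaIC α (R i))
      (fun σ => (σ a : ℕ) = (σ b : ℕ) + 1) t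
    rw [sum_alphaIC] at h
    have hp := div_le_sum_alphaIC_immediatelyAbove hα2 (R i) hab
    have hq : (1 - x) * x ≤ α / m := by
      rw [div_eq_mul_one_div]
      exact mul_le_mul_of_nonneg_right hα1 hx0.le
    have hle := mul_le_mul_of_nonneg_left (hq.trans hp) hexp.le
    refine (le_of_eq ?_).trans (sub_le_sub_left hle 1)
    convert h
  have hprod : ∏ i, ∑ σ, alphaIC α (R i) σ *
      Real.exp (-t * (if (σ a : ℕ) = (σ b : ℕ) + 1 then 1 else 0)) < Real.exp (-(n * y)) := by
    have hnn : ∀ i, 0 ≤ ∑ σ, alphaIC α (R i) σ *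
        Real.exp (-t * (if (σ a : ℕ) = (σ b : ℕ) + 1 then 1 else 0)) := fun i =>
      sum_nonneg fun σ _ => mul_nonneg (alphaIC_nonneg hα0 hα2 _ _) (Real.exp_pos _).le
    calc _ ≤ ∏ _i : Fin n, (1 - y) := prod_le_prod (fun i _ => hnn i) fun i _ => hmgf i
      _ = (1 - y) ^ n := by simp
      _ < Real.exp (-y) ^ n :=
        pow_lt_pow_left₀ (Real.one_sub_lt_exp_neg hy0.ne')
          ((hnn ⟨0, hn⟩).trans (hmgf _)) hn.ne'
      _ = _ := by rw [← Real.exp_nat_mul, mul_neg]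
  have hmarkov := profileProb_card_lt_le (fun i => alphaIC α (R i))
    (fun i σ => alphaIC_nonneg hα0 hα2 (R i) σ) (fun σ => (σ a : ℕ) = (σ b : ℕ) + 1)
    ((3 / 4 - 1 / (2 * (m : ℝ))) * (n : ℝ) / (m : ℝ)) ht0.le
  have hexponent : t * ((3 / 4 - 1 / (2 * (m : ℝ))) * (n : ℝ) / (m : ℝ)) + -(n * y) ≤
      -(n : ℝ) / (72 * (m : ℝ) ^ 2) := by
    have e1 : (3 / 4 - 1 / (2 * (m : ℝ))) * (n : ℝ) / (m : ℝ) = n * ((3 / 4 - x / 2) * x) := by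
      rw [hx]
      field_simp
    have e2 : -(n : ℝ) / (72 * (m : ℝ) ^ 2) = n * (-x ^ 2 / 72) := by
      rw [hx]
      field_simp
    have hy1 : t * ((1 - x) * x) - t ^ 2 / 8 ≤ y := by
      have h := mul_le_mul_of_nonneg_right (exp_neg_le_quadratic ht0.le) hp0.le
      have h' := mul_le_mul_of_nonneg_left hp1 (by positivity : 0 ≤ t ^ 2 / 2)
      rw [hy]
      linarith
    have key : t * ((3 / 4 - x / 2) * x) - y ≤ -x ^ 2 / 72 := by
      have h3 : 0 ≤ x ^ 2 * (1 / 3 - x) := mul_nonneg (by positivity) (by linarith)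
      rw [ht] at hy1 ⊢
      linarith
    rw [e1, e2]
    have := mul_le_mul_of_nonneg_left key hn'.le
    linarith
  calc _ ≤ Real.exp (t * ((3 / 4 - 1 / (2 * (m : ℝ))) * (n : ℝ) / (m : ℝ))) *
        ∏ i, ∑ σ, alphaIC α (R i) σ *
          Real.exp (-t * (if (σ a : ℕ) = (σ b : ℕ) + 1 then 1 else 0)) := by
        convert hmarkov
    _ < Real.exp (t * ((3 / 4 - 1 / (2 * (m : ℝ))) * (n : ℝ) / (m : ℝ))) *
        Real.exp (-(n * y)) :=
      mul_lt_mul_of_pos_left hprod (Real.exp_pos _)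
    _ ≤ _ := by
      rw [← Real.exp_add]
      exact Real.exp_le_exp.mpr hexponent
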